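/- Let p: ℝⁿ → ℝ be a multilinear polynomial with Var_{γ_n}(p) = 1, and define q: ℝ^{n·k} → ℝ by q(X₁,…,X_k) = (1/√k)·(p(X₁) + … + p(X_k)), where X₁,…,X_k are k disjoint blocks of n variables. Then q is (1/√k)-eigenregular. -/

import Mathlib

open MeasureTheory ProbabilityTheory MvPolynomial
open scoped Classical

noncomputable section

namespace GaussNS

/-- The standard Gaussian measure `γ` on `ι → ℝ`. -/
def gaussianPi (ι : Type*) [Fintype ι] : Measure (ι → ℝ) :=
  Measure.pi fun _ => gaussianReal 0 1

/-- `Fin k` embedded as the standard basis vectors `e₁, …, e_k` of `ℝᵏ`. -/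
def basisVec {k : ℕ} (i : Fin k) : Fin k → ℝ := fun j => if j = i then 1 else 0

/-- The Ornstein–Uhlenbeck operator `P_t` acting on scalar functions:
`(P_t f)(x) = ∫ f(e^{-t} x + √(1-e^{-2t}) y) dγ(y)`. -/
def ouOp {ι : Type*} [Fintype ι] (t : ℝ) (f : (ι → ℝ) → ℝ) (x : ι → ℝ) : ℝ :=
  ∫ y, f (fun i => Real.exp (-t) * x i + Real.sqrt (1 - Real.exp (-2 * t)) * y i) ∂gaussianPi ι

/-- Noise stability `E⟨f, P_t f⟩` of a `[k]`-valued function on Gaussian space,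
where `f` is identified with a basis-vector-valued function. -/
def noiseStab {ι : Type*} [Fintype ι] {k : ℕ} (t : ℝ) (f : (ι → ℝ) → Fin k) : ℝ :=
  ∫ x, ∑ j, basisVec (f x) j * ouOp t (fun y => basisVec (f y) j) x ∂gaussianPi ι

/-- The mean vector `E[f] ∈ Δ_k` of a `[k]`-valued function. -/
def gMean {ι : Type*} [Fintype ι] {k : ℕ} (f : (ι → ℝ) → Fin k) : Fin k → ℝ :=
  fun j => ∫ x, basisVec (f x) j ∂gaussianPi ι

/-- The multivariate polynomial threshold function `PTF(p₁,…,p_k)`: value `j` if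
`p j > 0` and `p i ≤ 0` for all `i ≠ j`, and the first index otherwise. -/
def ptf {ι : Type*} {k : ℕ} [NeZero k] (p : Fin k → MvPolynomial ι ℝ) (x : ι → ℝ) : Fin k :=
  if h : ∃ j, 0 < eval x (p j) ∧ ∀ i, i ≠ j → eval x (p i) ≤ 0 then h.choose else 0

/-- Collision set of a multivariate PTF: points where the number of strictly
positive `p j` is not exactly one. -/
def collisionSet {ι : Type*} {k : ℕ} (p : Fin k → MvPolynomial ι ℝ) : Set (ι → ℝ) :=
  {x | ¬ ∃! j, 0 < eval x (p j)}

/-- Gaussian expectation of a polynomial. -/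
def gExp {ι : Type*} [Fintype ι] (p : MvPolynomial ι ℝ) : ℝ :=
  ∫ x, eval x p ∂gaussianPi ι

/-- Gaussian variance of a polynomial. -/
def gVar {ι : Type*} [Fintype ι] (p : MvPolynomial ι ℝ) : ℝ :=
  (∫ x, (eval x p) ^ 2 ∂gaussianPi ι) - gExp p ^ 2

/-- A family `p₁,…,p_k` of polynomials is `(d, δ)`-balanced if each `p i` has Gaussian
variance `1` and `|E[p i]| ≤ (log (k d / δ))^{d/2}`. -/
def balancedFam {ι : Type*} [Fintype ι] {k : ℕ} (d : ℕ) (δ : ℝ)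
    (p : Fin k → MvPolynomial ι ℝ) : Prop :=
  ∀ i, gVar (p i) = 1 ∧ |gExp (p i)| ≤ Real.log ((k : ℝ) * d / δ) ^ ((d : ℝ) / 2)

/-- The normalized multivariate Hermite polynomial `H_S(x) = ∏ i, H_{S i}(x i)/√(S i)!`. -/
def hermiteH {ι : Type*} [Fintype ι] (S : ι → ℕ) (x : ι → ℝ) : ℝ :=
  ∏ i, (Polynomial.aeval (x i) (Polynomial.hermite (S i)) / Real.sqrt (Nat.factorial (S i)))

/-- The Hermite coefficient `f̂(S) = E[f · H_S]`. -/
def hermCoeff {ι : Type*} [Fintype ι] (f : (ι → ℝ) → ℝ) (S : ι → ℕ) : ℝ :=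
  ∫ x, f x * hermiteH S x ∂gaussianPi ι

/-- Hermite weight `W^{>d}[f] = Σ_{|S| > d} ‖f̂(S)‖²` of a vector-valued function. -/
def wAbove {ι : Type*} [Fintype ι] {k : ℕ} (d : ℕ) (f : (ι → ℝ) → Fin k → ℝ) : ℝ :=
  ∑' S : ι → ℕ, if d < ∑ i, S i then ∑ j, hermCoeff (fun x => f x j) S ^ 2 else 0

/-- Hermite weight `W^{≥d}[f] = Σ_{|S| ≥ d} f̂(S)²` of a scalar function. -/
def wGE {ι : Type*} [Fintype ι] (d : ℕ) (f : (ι → ℝ) → ℝ) : ℝ :=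
  ∑' S : ι → ℕ, if d ≤ ∑ i, S i then hermCoeff f S ^ 2 else 0

/-- Squared `L²(γ)` norm `Σ_{|S| = q} f̂(S)²` of the projection of `f` onto
the `q`-th Wiener chaos. -/
def chaosNormSq {ι : Type*} [Fintype ι] (q : ℕ) (f : (ι → ℝ) → ℝ) : ℝ :=
  ∑' S : ι → ℕ, if (∑ i, S i) = q then hermCoeff f S ^ 2 else 0

/-- Frobenius norm of a tensor. -/
def frobNorm {α ι : Type*} [Fintype α] [Fintype ι] (T : (α → ι) → ℝ) : ℝ :=
  Real.sqrt (∑ t, T t ^ 2)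

/-- Contraction product `f ⊗_r g` of an order-`p` and an order-`q` tensor along `r`
indices, presented as a tensor in the remaining `(p-r)` and `(q-r)` indices. -/
def contr {ι : Type*} [Fintype ι] {p q r : ℕ} (hp : r ≤ p) (hq : r ≤ q)
    (f : (Fin p → ι) → ℝ) (g : (Fin q → ι) → ℝ)
    (a : Fin (p - r) → ι) (b : Fin (q - r) → ι) : ℝ :=
  ∑ z : Fin r → ι,
    f (fun i => Fin.append a z (Fin.cast (Nat.sub_add_cancel hp).symm i)) *
      g (fun i => Fin.append b z (Fin.cast (Nat.sub_add_cancel hq).symm i))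

/-- `λ_{S,S̄}(A)`: the largest singular value of the matricization of `A` along the
partition `(S, S̄)` of its index set. -/
def lamPart {ι : Type*} [Fintype ι] {q : ℕ} (A : (Fin q → ι) → ℝ) (S : Finset (Fin q)) : ℝ :=
  ⨆ g : ({i // i ∈ S} → ι) → ℝ, ⨆ h : ({i // i ∉ S} → ι) → ℝ,
    (∑ t : Fin q → ι, A t * g (fun i => t i.1) * h (fun i => t i.1)) /
      (frobNorm g * frobNorm h)

/-- `λ_max(A)`: maximum of `λ_{S,S̄}(A)` over nontrivial partitions `(S, S̄)`. -/
def lamMax {ι : Type*} [Fintype ι] {q : ℕ} (A : (Fin q → ι) → ℝ) : ℝ :=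
  ⨆ S : {S : Finset (Fin q) // S ≠ ∅ ∧ S ≠ Finset.univ}, lamPart A S.1

/-- The symmetric tensor `A_q` with `p = Σ_q I_q(A_q)` for a multilinear polynomial
(in terms of its Hermite coefficients). -/
def chaosTensor {ι : Type*} [Fintype ι] [DecidableEq ι] (f : (ι → ℝ) → ℝ) (q : ℕ) :
    (Fin q → ι) → ℝ :=
  fun t => if Function.Injective t then
      hermCoeff f (fun i => (Finset.univ.filter fun j => t j = i).card) / Real.sqrt (Nat.factorial q)
    else 0

/-- `λ_max(p) = max_{2 ≤ q ≤ deg p} λ_max(A_q)`. -/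
def polyLamMax {ι : Type*} [Fintype ι] [DecidableEq ι] (p : MvPolynomial ι ℝ) : ℝ :=
  ⨆ q : {q : ℕ // 2 ≤ q ∧ q ≤ p.totalDegree}, lamMax (chaosTensor (fun x => eval x p) q.1)

/-- A polynomial is `δ`-eigenregular if `λ_max(p) ≤ δ √(Var p)`. -/
def eigenregular {ι : Type*} [Fintype ι] [DecidableEq ι] (δ : ℝ) (p : MvPolynomial ι ℝ) : Prop :=
  polyLamMax p ≤ δ * Real.sqrt (gVar p)

/-- `p` lies in the `j`-th Wiener chaos `W^j`. -/
def inChaos {ι : Type*} [Fintype ι] (j : ℕ) (p : MvPolynomial ι ℝ) : Prop :=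
  ∀ S : ι → ℕ, (∑ i, S i) ≠ j → hermCoeff (fun x => eval x p) S = 0

/-- Expectation over the uniform measure on the hypercube `{-1,1}ⁿ ≃ Boolⁿ`. -/
def cubeE {n : ℕ} (g : (Fin n → Bool) → ℝ) : ℝ := (∑ x, g x) / 2 ^ n

/-- The Bonami–Beckner operator `T_ρ` on the hypercube. -/
def bbOp {n : ℕ} (ρ : ℝ) (g : (Fin n → Bool) → ℝ) (x : Fin n → Bool) : ℝ :=
  ∑ y : Fin n → Bool, (∏ i, if y i = x i then (1 + ρ) / 2 else (1 - ρ) / 2) * g y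

/-- Noise stability `E⟨f, T_ρ f⟩` on the hypercube of a `[k]`-valued function. -/
def cubeStab {n k : ℕ} (ρ : ℝ) (f : (Fin n → Bool) → Fin k) : ℝ :=
  cubeE fun x => ∑ j, basisVec (f x) j * bbOp ρ (fun y => basisVec (f y) j) x

/-- Influence of coordinate `i`: `Inf_i(f) = E_z[Var(f_{z,-i})]`, computed as
`E_x[‖f(x) - f(x^{⊕i})‖² / 4]`. -/
def influence {n k : ℕ} (i : Fin n) (f : (Fin n → Bool) → Fin k → ℝ) : ℝ :=
  cubeE fun x => (∑ j, (f x j - f (Function.update x i (!(x i))) j) ^ 2) / 4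

/-- `g ∈ T_z(F)`: `g` is a measurable rounding of `F` by thresholding at `z`, i.e.
`⟨e_{g(x)}, F(x) - z⟩ ≥ F_i(x) - z_i` for all `i` and `x`. -/
def memTz {ι : Type*} [Fintype ι] {k : ℕ} (z : Fin k → ℝ) (F : (ι → ℝ) → Fin k → ℝ)
    (g : (ι → ℝ) → Fin k) : Prop :=
  Measurable (fun x => basisVec (g x)) ∧ ∀ x i, F x i - z i ≤ F x (g x) - z (g x)

/-- `V` bounds the Gaussian total variation `E[|∇f|]` of `f`, characterized
distributionally: for every `C¹` compactly supported vector field `φ` with `‖φ‖ ≤ 1`,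
`∫ f · (div φ - ⟨x, φ⟩) dγ ≤ V`.  The least such `V` is `E[|∇f|]`. -/
def gaussTV {n : ℕ} (f : (Fin n → ℝ) → ℝ) (V : ℝ) : Prop :=
  ∀ φ : (Fin n → ℝ) → (Fin n → ℝ), ContDiff ℝ 1 φ → HasCompactSupport φ →
    (∀ x, Real.sqrt (∑ i, φ x i ^ 2) ≤ 1) →
    (∫ x, f x * ((∑ i, fderiv ℝ (fun y => φ y i) x (Pi.single i 1)) - ∑ i, x i * φ x i)
        ∂gaussianPi (Fin n)) ≤ V

/-- Evaluation of a polynomial at the noisy point `e^{-t} x + √(1-e^{-2t}) y`. -/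
def corrEval {m : ℕ} (t : ℝ) (p : MvPolynomial (Fin m) ℝ)
    (xy : (Fin m → ℝ) × (Fin m → ℝ)) : ℝ :=
  eval (fun i => Real.exp (-t) * xy.1 i + Real.sqrt (1 - Real.exp (-2 * t)) * xy.2 i) p

end GaussNS

open GaussNS

/-- The multilinear monomial `∏ i ∈ T, x i`. -/
def multilinMonomial {ι : Type*} (T : Finset ι) (x : ι → ℝ) : ℝ := ∏ i ∈ T, x i

section

variable {ι : Type*} [Fintype ι]

instance : IsProbabilityMeasure (gaussianPi ι) := by
  unfold gaussianPi; infer_instance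

lemma integrable_id_gaussianReal : Integrable (fun y : ℝ => y) (gaussianReal 0 1) :=
  (memLp_id_gaussianReal 1).integrable le_rfl

lemma integrable_sq_gaussianReal : Integrable (fun y : ℝ => y ^ 2) (gaussianReal 0 1) :=
  (memLp_id_gaussianReal 2).integrable_sq

lemma integral_sq_gaussianReal : ∫ y, y ^ 2 ∂gaussianReal 0 1 = 1 := by
  have h := variance_eq_sub (memLp_id_gaussianReal (μ := 0) (v := 1) 2)
  simpa using h.symm

lemma multilinMonomial_mul_eq_prod (T U : Finset ι) (x : ι → ℝ) :
    multilinMonomial T x * multilinMonomial U x =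
      ∏ i, (if i ∈ T then x i else 1) * (if i ∈ U then x i else 1) := by
  rw [Finset.prod_mul_distrib]
  simp [multilinMonomial]

lemma integrable_multilinMonomial_mul (T U : Finset ι) :
    Integrable (fun x => multilinMonomial T x * multilinMonomial U x) (gaussianPi ι) := by
  simp only [multilinMonomial_mul_eq_prod]
  refine Integrable.fintype_prod (𝕜 := ℝ)
    (f := fun i y => (if i ∈ T then y else 1) * (if i ∈ U then y else 1)) fun i => ?_
  by_cases hT : i ∈ T <;> by_cases hU : i ∈ U <;>
    simp [hT, hU, ← pow_two, integrable_id_gaussianReal, integrable_sq_gaussianReal]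

lemma integral_multilinMonomial_mul (T U : Finset ι) :
    ∫ x, multilinMonomial T x * multilinMonomial U x ∂gaussianPi ι = if T = U then 1 else 0 := by
  simp only [multilinMonomial_mul_eq_prod]
  rw [gaussianPi, integral_fintype_prod_eq_prod
    (f := fun i y => (if i ∈ T then y else 1) * (if i ∈ U then y else 1))]
  split_ifs with h
  · subst h
    refine Finset.prod_eq_one fun i _ => ?_
    by_cases hT : i ∈ T <;> simp [hT, ← pow_two, integral_sq_gaussianReal]
  · obtain ⟨i, hi⟩ : ∃ i, ¬ (i ∈ T ↔ i ∈ U) := by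
      by_contra! hc
      exact h (Finset.ext hc)
    refine Finset.prod_eq_zero (Finset.mem_univ i) ?_
    by_cases hT : i ∈ T <;> by_cases hU : i ∈ U <;> simp_all

lemma integral_sum_mul_multilinMonomial (c : Finset ι → ℝ) (U : Finset ι) :
    ∫ x, (∑ T, c T * multilinMonomial T x) * multilinMonomial U x ∂gaussianPi ι = c U := by
  simp only [Finset.sum_mul, mul_assoc]
  rw [integral_finsetSum _ fun T _ => (integrable_multilinMonomial_mul T U).const_mul _]
  simp [integral_const_mul, integral_multilinMonomial_mul]

lemma integrable_sum_mul_multilinMonomial (c : Finset ι → ℝ) (U : Finset ι) :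
    Integrable (fun x => (∑ T, c T * multilinMonomial T x) * multilinMonomial U x)
      (gaussianPi ι) := by
  simp only [Finset.sum_mul, mul_assoc]
  exact integrable_finsetSum _ fun T _ => (integrable_multilinMonomial_mul T U).const_mul _

lemma integral_sum_multilinMonomial_sq (c : Finset ι → ℝ) :
    ∫ x, (∑ T, c T * multilinMonomial T x) ^ 2 ∂gaussianPi ι = ∑ T, c T ^ 2 := by
  have (x : ι → ℝ) : (∑ T, c T * multilinMonomial T x) ^ 2 =
      ∑ U, c U * ((∑ T, c T * multilinMonomial T x) * multilinMonomial U x) := by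
    rw [pow_two, Finset.mul_sum]
    exact Finset.sum_congr rfl fun U _ => by ring
  simp only [this]
  rw [integral_finsetSum _ fun U _ => (integrable_sum_mul_multilinMonomial c U).const_mul _]
  simp [integral_const_mul, integral_sum_mul_multilinMonomial, pow_two]

lemma gVar_eq_sum_sq [DecidableEq ι] {p : MvPolynomial ι ℝ} {c : Finset ι → ℝ}
    (hc : ∀ x, eval x p = ∑ T, c T * multilinMonomial T x) :
    gVar p = ∑ T ∈ Finset.univ.erase ∅, c T ^ 2 := by
  have h := integral_sum_mul_multilinMonomial c ∅
  simp only [multilinMonomial, Finset.prod_empty, mul_one] at h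
  rw [gVar, gExp]
  simp only [hc, integral_sum_multilinMonomial_sq]
  rw [show (∫ x, ∑ T, c T * multilinMonomial T x ∂gaussianPi ι) = c ∅ from h,
    ← Finset.add_sum_erase _ _ (Finset.mem_univ (∅ : Finset ι))]
  ring

lemma exists_eval_eq_sum_multilinMonomial {p : MvPolynomial ι ℝ} (hp : ∀ i, p.degreeOf i ≤ 1) :
    ∃ c : Finset ι → ℝ, ∀ x, eval x p = ∑ T, c T * multilinMonomial T x := by
  refine ⟨fun T => ∑ m ∈ p.support with m.support = T, p.coeff m, fun x => ?_⟩
  rw [eval_eq, ← Finset.sum_fiberwise p.support fun m => m.support]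
  refine Finset.sum_congr rfl fun T _ => ?_
  rw [Finset.sum_mul]
  refine Finset.sum_congr rfl fun m hm => ?_
  rw [Finset.mem_filter] at hm
  rw [← hm.2, multilinMonomial]
  congr 1
  refine Finset.prod_congr rfl fun i hi => ?_
  have h1 : m i ≤ 1 := (monomial_le_degreeOf i hm.1).trans (hp i)
  have h2 : m i ≠ 0 := Finsupp.mem_support_iff.mp hi
  rw [show m i = 1 by omega, pow_one]

lemma hermiteH_card_fiber [DecidableEq ι] {q : ℕ} {t : Fin q → ι} (ht : Function.Injective t)
    (x : ι → ℝ) :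
    hermiteH (fun i => (Finset.univ.filter fun j => t j = i).card) x =
      multilinMonomial (Finset.univ.image t) x := by
  rw [hermiteH, multilinMonomial, ← Finset.prod_subset (Finset.subset_univ (Finset.univ.image t))]
  · refine Finset.prod_congr rfl fun i hi => ?_
    obtain ⟨j, -, rfl⟩ := Finset.mem_image.mp hi
    have : (Finset.univ.filter fun l => t l = t j).card = 1 :=
      Finset.card_eq_one.mpr ⟨j, by ext l; simp [ht.eq_iff]⟩
    simp [this]
  · intro i _ hi
    have : (Finset.univ.filter fun l => t l = i).card = 0 := by
      rw [Finset.card_eq_zero, Finset.filter_eq_empty_iff]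
      rintro l - rfl
      exact hi (Finset.mem_image_of_mem t (Finset.mem_univ l))
    simp [this]

lemma chaosTensor_eq [DecidableEq ι] {f : (ι → ℝ) → ℝ} {c : Finset ι → ℝ}
    (hc : ∀ x, f x = ∑ T, c T * multilinMonomial T x) {q : ℕ} (t : Fin q → ι) :
    chaosTensor f q t = if Function.Injective t then
      c (Finset.univ.image t) / Real.sqrt (Nat.factorial q) else 0 := by
  unfold chaosTensor
  split_ifs with ht
  · simp only [hermCoeff, hermiteH_card_fiber ht, hc, integral_sum_mul_multilinMonomial]
  · rfl

lemma card_injective_image_eq_le [DecidableEq ι] (q : ℕ) (T : Finset ι) :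
    (Finset.univ.filter fun t : Fin q → ι =>
      Function.Injective t ∧ Finset.univ.image t = T).card ≤ q.factorial := by
  by_cases hT : T.card = q
  · calc _ ≤ (Finset.univ : Finset (Fin q ↪ T)).card := by
          refine Finset.card_le_card_of_surjOn (fun e i => (e i : ι)) ?_
          intro t ht
          simp only [Finset.coe_filter, Finset.mem_univ, true_and, Set.mem_ofPred_eq] at ht
          refine ⟨⟨fun i => ⟨t i, ht.2 ▸ Finset.mem_image_of_mem t (Finset.mem_univ i)⟩, ?_⟩,
            by simp, rfl⟩
          intro i j hij
          exact ht.1 (congrArg Subtype.val hij)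
      _ = q.factorial := by
          simp [Finset.card_univ, Fintype.card_embedding_eq, hT, Nat.descFactorial_self]
  · rw [Finset.card_eq_zero.mpr]
    · exact Nat.zero_le _
    · rw [Finset.filter_eq_empty_iff]
      rintro t - ⟨ht, rfl⟩
      exact hT (by rw [Finset.card_image_of_injective _ ht]; simp)

lemma sum_chaosTensor_sq_le_gVar [DecidableEq ι] {p : MvPolynomial ι ℝ} {c : Finset ι → ℝ}
    (hc : ∀ x, eval x p = ∑ T, c T * multilinMonomial T x) {q : ℕ} (hq : q ≠ 0) :
    ∑ t, chaosTensor (fun x => eval x p) q t ^ 2 ≤ gVar p := by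
  have : Nonempty (Fin q) := ⟨⟨0, Nat.pos_of_ne_zero hq⟩⟩
  have hfac : (0 : ℝ) < q.factorial := by exact_mod_cast q.factorial_pos
  rw [gVar_eq_sum_sq hc]
  calc ∑ t, chaosTensor (fun x => eval x p) q t ^ 2
      = ∑ t : Fin q → ι with Function.Injective t,
          c (Finset.univ.image t) ^ 2 / q.factorial := by
        rw [Finset.sum_filter]
        refine Finset.sum_congr rfl fun t _ => ?_
        rw [chaosTensor_eq hc]
        split_ifs
        · rw [div_pow, Real.sq_sqrt hfac.le]
        · simp
    _ = ∑ T ∈ Finset.univ.erase (∅ : Finset ι),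
          ∑ t : Fin q → ι with Function.Injective t ∧ Finset.univ.image t = T,
            c T ^ 2 / q.factorial := by
        rw [← Finset.sum_fiberwise_of_maps_to
          (t := Finset.univ.erase (∅ : Finset ι)) (g := fun t => Finset.univ.image t)]
        · refine Finset.sum_congr rfl fun T _ => ?_
          rw [Finset.filter_filter]
          refine Finset.sum_congr rfl fun t ht => ?_
          rw [(Finset.mem_filter.mp ht).2.2]
        · intro t _
          simp [Finset.univ_nonempty.ne_empty]
    _ ≤ _ := by
        refine Finset.sum_le_sum fun T _ => ?_
        rw [Finset.sum_const, nsmul_eq_mul, mul_div_assoc', div_le_iff₀ hfac, mul_comm]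
        refine mul_le_mul_of_nonneg_left ?_ (sq_nonneg _)
        exact_mod_cast card_injective_image_eq_le q T

lemma frobNorm_chaosTensor_le [DecidableEq ι] {p : MvPolynomial ι ℝ} {c : Finset ι → ℝ}
    (hc : ∀ x, eval x p = ∑ T, c T * multilinMonomial T x) {q : ℕ} (hq : q ≠ 0) :
    frobNorm (chaosTensor (fun x => eval x p) q) ≤ Real.sqrt (gVar p) := by
  refine Real.sqrt_le_sqrt ?_
  convert sum_chaosTensor_sq_le_gVar hc hq

end

lemma map_sectR_eq_map_sectR_iff {κ ι : Type*} {j l : κ} {T U : Finset ι} (hT : T.Nonempty) :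
    U.map (Function.Embedding.sectR l ι) = T.map (Function.Embedding.sectR j ι) ↔
      l = j ∧ U = T := by
  refine ⟨fun h => ?_, by rintro ⟨rfl, rfl⟩; rfl⟩
  obtain ⟨i, hi⟩ := hT
  have hmem : (j, i) ∈ U.map (Function.Embedding.sectR l ι) := by
    rw [h]
    exact Finset.mem_map_of_mem (Function.Embedding.sectR j ι) hi
  obtain ⟨i', -, hi'⟩ := Finset.mem_map.mp hmem
  obtain rfl : l = j := congrArg Prod.fst hi'
  exact ⟨rfl, Finset.map_injective _ h⟩

section Blocks

variable {κ ι : Type*} [Fintype κ] [Fintype ι]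

/-- The coefficients of `a * ∑ j, p(X_j)` in terms of those of `p`. -/
def blockCoeff (a : ℝ) (c : Finset ι → ℝ) (U : Finset (κ × ι)) : ℝ :=
  a * ∑ j : κ, ∑ T : Finset ι, if T.map (Function.Embedding.sectR j ι) = U then c T else 0

lemma eval_block_sum {p : MvPolynomial ι ℝ} {c : Finset ι → ℝ}
    (hc : ∀ x, eval x p = ∑ T, c T * multilinMonomial T x) (a : ℝ) (x : κ × ι → ℝ) :
    eval x (C a * ∑ j : κ, rename (fun i => (j, i)) p) =
      ∑ U, blockCoeff a c U * multilinMonomial U x := by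
  simp only [map_mul, eval_C, map_sum, eval_rename, hc, blockCoeff, mul_assoc, ← Finset.mul_sum]
  congr 1
  simp only [Finset.sum_mul]
  rw [Finset.sum_comm (s := (Finset.univ : Finset (Finset (κ × ι))))]
  refine Finset.sum_congr rfl fun j _ => ?_
  rw [Finset.sum_comm (s := (Finset.univ : Finset (Finset (κ × ι))))]
  refine Finset.sum_congr rfl fun T _ => ?_
  simp [ite_mul, multilinMonomial]

lemma blockCoeff_map_sectR (a : ℝ) (c : Finset ι → ℝ) (j : κ) {T : Finset ι} (hT : T.Nonempty) :
    blockCoeff a c (T.map (Function.Embedding.sectR j ι)) = a * c T := by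
  simp [blockCoeff, map_sectR_eq_map_sectR_iff hT, ite_and]

lemma gVar_block_sum_ge {p : MvPolynomial ι ℝ} {c : Finset ι → ℝ}
    (hc : ∀ x, eval x p = ∑ T, c T * multilinMonomial T x) (a : ℝ) :
    Fintype.card κ * a ^ 2 * gVar p ≤ gVar (C a * ∑ j : κ, rename (fun i => (j, i)) p) := by
  rw [gVar_eq_sum_sq hc, gVar_eq_sum_sq (eval_block_sum hc a)]
  let e : κ × Finset ι → Finset (κ × ι) := fun z => z.2.map (Function.Embedding.sectR z.1 ι)
  have hinj : Set.InjOn e (Finset.univ ×ˢ Finset.univ.erase ∅ : Finset (κ × Finset ι)) := by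
    rintro ⟨l, U⟩ - ⟨j, T⟩ hT h
    have hT' : T.Nonempty := by simpa [Finset.nonempty_iff_ne_empty] using hT
    obtain ⟨rfl, rfl⟩ := (map_sectR_eq_map_sectR_iff hT').mp h
    rfl
  calc _ = ∑ z ∈ (Finset.univ ×ˢ Finset.univ.erase ∅ : Finset (κ × Finset ι)),
          blockCoeff a c (e z) ^ 2 := by
        rw [Finset.sum_product, mul_assoc, Finset.mul_sum, ← nsmul_eq_mul, ← Finset.card_univ,
          ← Finset.sum_const]
        refine Finset.sum_congr rfl fun j _ => Finset.sum_congr rfl fun T hT => ?_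
        rw [blockCoeff_map_sectR a c j (Finset.nonempty_iff_ne_empty.mpr (Finset.ne_of_mem_erase hT)),
          mul_pow]
    _ = ∑ U ∈ (Finset.univ ×ˢ Finset.univ.erase ∅ : Finset (κ × Finset ι)).image e,
          blockCoeff a c U ^ 2 :=
        (Finset.sum_image (f := fun U => blockCoeff a c U ^ 2) hinj).symm
    _ ≤ _ := by
        refine Finset.sum_le_sum_of_subset_of_nonneg ?_ fun _ _ _ => sq_nonneg _
        intro U hU
        obtain ⟨⟨j, T⟩, hT, rfl⟩ := Finset.mem_image.mp hU
        simpa [e] using hT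

lemma chaosTensor_block_sum [DecidableEq (κ × ι)] [DecidableEq ι] {p : MvPolynomial ι ℝ}
    {c : Finset ι → ℝ} (hc : ∀ x, eval x p = ∑ T, c T * multilinMonomial T x) (a : ℝ)
    {q : ℕ} (hq : q ≠ 0) (t : Fin q → κ × ι) :
    chaosTensor (fun x => eval x (C a * ∑ j : κ, rename (fun i => (j, i)) p)) q t =
      a * ∑ j : κ, if (fun i => (t i).1) = (fun _ => j) then
        chaosTensor (fun x => eval x p) q (fun i => (t i).2) else 0 := by
  have : Nonempty (Fin q) := ⟨⟨0, Nat.pos_of_ne_zero hq⟩⟩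
  rw [chaosTensor_eq (eval_block_sum hc a)]
  simp only [chaosTensor_eq hc]
  by_cases h : ∃ j, (fun i => (t i).1) = fun _ => j
  · obtain ⟨j, hj⟩ := h
    obtain ⟨s, rfl⟩ : ∃ s : Fin q → ι, t = fun i => (j, s i) :=
      ⟨fun i => (t i).2, funext fun i => Prod.ext (congrFun hj i) rfl⟩
    have hs : Function.Injective (fun i => (j, s i)) ↔ Function.Injective s :=
      ⟨fun h a b hab => h (by simp [hab]), fun h a b hab => h (congrArg Prod.snd hab)⟩
    have himg : Finset.univ.image (fun i => (j, s i)) =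
        (Finset.univ.image s).map (Function.Embedding.sectR j ι) := by
      ext ⟨l, i⟩
      simp [and_comm, eq_comm]
    have hconst (l : κ) : ((fun _ : Fin q => j) = fun _ => l) ↔ j = l := by
      simp [funext_iff]
    simp only [hs, hconst, himg, Finset.sum_ite_eq, Finset.mem_univ, if_true]
    rw [blockCoeff_map_sectR _ _ _ (Finset.univ_nonempty.image s)]
    split_ifs <;> ring
  · have hzero : blockCoeff a c (Finset.univ.image t) = 0 := by
      unfold blockCoeff
      rw [Finset.sum_eq_zero, mul_zero]
      refine fun j _ => Finset.sum_eq_zero fun T _ => if_neg fun hT => h ⟨j, funext fun i => ?_⟩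
      have hi : t i ∈ T.map (Function.Embedding.sectR j ι) := by
        rw [hT]
        exact Finset.mem_image_of_mem t (Finset.mem_univ i)
      obtain ⟨i', -, hi'⟩ := Finset.mem_map.mp hi
      exact (congrArg Prod.fst hi').symm
    push Not at h
    simp [hzero, h]

end Blocks

lemma sum_mul_mul_le_frobNorm {ι : Type*} [Fintype ι] {q : ℕ} (A : (Fin q → ι) → ℝ)
    (S : Finset (Fin q)) (g : ({i // i ∈ S} → ι) → ℝ) (h : ({i // i ∉ S} → ι) → ℝ) :
    ∑ t : Fin q → ι, A t * g (fun i => t i.1) * h (fun i => t i.1) ≤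
      frobNorm A * (frobNorm g * frobNorm h) := by
  have hprod : ∑ t : Fin q → ι, (g (fun i => t i.1) * h (fun i => t i.1)) ^ 2 =
      (∑ u, g u ^ 2) * ∑ v, h v ^ 2 := by
    rw [Finset.sum_mul_sum, ← Fintype.sum_prod_type',
      ← (Equiv.piEquivPiSubtypeProd (fun i => i ∈ S) fun _ => ι).sum_comp]
    exact Finset.sum_congr rfl fun t _ => mul_pow _ _ _
  have := Real.sum_mul_le_sqrt_mul_sqrt Finset.univ A
    fun t => g (fun i => t i.1) * h (fun i => t i.1)
  rw [hprod, Real.sqrt_mul (Finset.sum_nonneg fun _ _ => sq_nonneg _)] at this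
  simp only [mul_assoc, frobNorm]
  convert this

lemma sum_frobNorm_block_sq_le {κ ι α : Type*} [Fintype κ] [Fintype ι] [Fintype α] [Nonempty α]
    (g : (α → κ × ι) → ℝ) :
    ∑ j : κ, frobNorm (fun u : α → ι => g fun i => (j, u i)) ^ 2 ≤ frobNorm g ^ 2 := by
  simp only [frobNorm, Real.sq_sqrt (Finset.sum_nonneg fun _ _ => sq_nonneg _)]
  have hinj : Function.Injective fun (z : κ × (α → ι)) (i : α) => (z.1, z.2 i) := by
    rintro ⟨j, u⟩ ⟨l, v⟩ h
    obtain ⟨i⟩ := ‹Nonempty α›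
    have h (i : α) : (j, u i) = (l, v i) := congrFun h i
    exact Prod.ext (congrArg (fun z : κ × ι => z.1) (h i)) (funext fun i => congrArg Prod.snd (h i))
  rw [← Fintype.sum_prod_type']
  calc _ = ∑ t ∈ Finset.univ.image fun (z : κ × (α → ι)) (i : α) => (z.1, z.2 i), g t ^ 2 :=
        (Finset.sum_image hinj.injOn).symm
    _ ≤ _ := Finset.sum_le_sum_of_subset_of_nonneg (Finset.subset_univ _) fun _ _ _ => sq_nonneg _

lemma frobNorm_nonneg {α ι : Type*} [Fintype α] [Fintype ι] (T : (α → ι) → ℝ) :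
    0 ≤ frobNorm T := Real.sqrt_nonneg _

lemma lamPart_block_le {κ ι : Type*} [Fintype κ] [Fintype ι] {q : ℕ}
    {A : (Fin q → κ × ι) → ℝ} {B : (Fin q → ι) → ℝ} {a : ℝ} (ha : 0 ≤ a)
    (hA : ∀ t, A t = a * ∑ j : κ, if (fun i => (t i).1) = (fun _ => j) then
      B (fun i => (t i).2) else 0)
    {S : Finset (Fin q)} (hS : S ≠ ∅) (hS' : S ≠ Finset.univ) :
    lamPart A S ≤ a * frobNorm B := by
  have : Nonempty {i // i ∈ S} := (Finset.nonempty_iff_ne_empty.mpr hS).to_subtype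
  have : Nonempty {i // i ∉ S} := by
    by_contra! hc
    exact hS' (Finset.eq_univ_of_forall fun i => by
      by_contra hi
      exact hc.false ⟨i, hi⟩)
  have hnn : 0 ≤ a * frobNorm B := mul_nonneg ha (frobNorm_nonneg B)
  refine Real.iSup_le (fun g => Real.iSup_le (fun h => ?_) hnn) hnn
  refine div_le_of_le_mul₀ (mul_nonneg (frobNorm_nonneg g) (frobNorm_nonneg h)) hnn ?_
  have hsum : ∑ t, A t * g (fun i => t i.1) * h (fun i => t i.1) =
      a * ∑ j : κ, ∑ s : Fin q → ι,
        B s * g (fun i => (j, s i.1)) * h (fun i => (j, s i.1)) := by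
    rw [← (Equiv.arrowProdEquivProdArrow (Fin q) (fun _ => κ) fun _ => ι).symm.sum_comp,
      Fintype.sum_prod_type_right, Finset.sum_comm (s := (Finset.univ : Finset κ)), Finset.mul_sum]
    refine Finset.sum_congr rfl fun s _ => ?_
    simp only [hA, Equiv.arrowProdEquivProdArrow, Equiv.coe_fn_symm_mk, Finset.mul_sum,
      Finset.sum_mul]
    rw [Finset.sum_comm]
    refine Finset.sum_congr rfl fun j _ => ?_
    rw [Finset.sum_eq_single (fun _ => j)]
    · simp [mul_assoc]
    · intro b _ hb
      rw [if_neg hb]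
      simp
    · simp
  rw [hsum, mul_assoc]
  refine mul_le_mul_of_nonneg_left ?_ ha
  calc _ ≤ ∑ j : κ, frobNorm B * (frobNorm (fun u : {i // i ∈ S} → ι => g fun i => (j, u i)) *
          frobNorm (fun u : {i // i ∉ S} → ι => h fun i => (j, u i))) :=
        Finset.sum_le_sum fun j _ => sum_mul_mul_le_frobNorm B S
          (fun u => g fun i => (j, u i)) (fun u => h fun i => (j, u i))
    _ ≤ _ := by
        rw [← Finset.mul_sum]
        refine mul_le_mul_of_nonneg_left ?_ (frobNorm_nonneg B)
        refine (Real.sum_mul_le_sqrt_mul_sqrt _ _ _).trans ?_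
        gcongr
        · exact frobNorm_nonneg g
        · exact Real.sqrt_le_iff.mpr ⟨frobNorm_nonneg g, sum_frobNorm_block_sq_le g⟩
        · exact Real.sqrt_le_iff.mpr ⟨frobNorm_nonneg h, sum_frobNorm_block_sq_le h⟩

/-- If `p` is a multilinear polynomial with `Var p = 1` and
`q(X₁,…,X_k) = (p(X₁)+⋯+p(X_k))/√k` on `k` disjoint blocks of variables, then `q`
is `(1/√k)`-eigenregular. -/
theorem stmt15 {n k : ℕ} (hk : 0 < k) (p : MvPolynomial (Fin n) ℝ)
    (hml : ∀ i, p.degreeOf i ≤ 1) (hvar : gVar p = 1) :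
    eigenregular (1 / Real.sqrt k)
      (MvPolynomial.C (1 / Real.sqrt k) *
        ∑ j : Fin k, MvPolynomial.rename (fun i => ((j, i) : Fin k × Fin n)) p) := by
  obtain ⟨c, hc⟩ := exists_eval_eq_sum_multilinMonomial hml
  have hk' : (0 : ℝ) < k := by exact_mod_cast hk
  have ha : 0 ≤ 1 / Real.sqrt k := by positivity
  have hVar := gVar_block_sum_ge (κ := Fin k) hc (1 / Real.sqrt k)
  rw [hvar, Fintype.card_fin, div_pow, Real.sq_sqrt hk'.le, one_pow, mul_one,
    mul_one_div_cancel hk'.ne'] at hVar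
  have hnn := mul_nonneg ha (Real.sqrt_nonneg
    (gVar (C (1 / Real.sqrt k) * ∑ j : Fin k, rename (fun i => ((j, i) : Fin k × Fin n)) p)))
  refine Real.iSup_le (fun q => Real.iSup_le (fun S => ?_) hnn) hnn
  have hq : q.1 ≠ 0 := by have := q.2.1; omega
  refine (lamPart_block_le ha (chaosTensor_block_sum hc _ hq) S.2.1 S.2.2).trans ?_
  refine mul_le_mul_of_nonneg_left ((frobNorm_chaosTensor_le hc hq).trans ?_) ha
  exact Real.sqrt_le_sqrt (hvar.le.trans hVar)
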